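/- arXiv:math/9408202 — 3 statements merged into one kernel-verified Lean document; each statement's English description precedes it below -/
import Mathlib

section
/- Let X be a Hausdorff topological space in which every point has a neighborhood basis of cardinality at most χ, and let λ be an infinite cardinal with χ ≤ λ. Then X is λ-CWH if and only if for every subset Y of X of cardinality at most λ whose subspace topology is discrete, there is a family ⟨u_y : y ∈ Y⟩ of pairwise disjoint open subsets of X with y ∈ u_y for each y ∈ Y. -/
open Cardinal Topology

universe u

/-- A family of pairwise disjoint open subsets of `X` separating the points of `Y`. -/
def SeparatedFamily {X : Type u} [TopologicalSpace X] (Y : Set X) : Prop :=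
  ∃ u : Y → Set X, (∀ y, IsOpen (u y)) ∧ (∀ y, (y : X) ∈ u y) ∧
    ∀ y z : Y, y ≠ z → Disjoint (u y) (u z)

/-- `X` is collectionwise Hausdorff: every subset whose subspace topology is discrete
can be separated by pairwise disjoint open sets. -/
def IsCWH (X : Type u) [TopologicalSpace X] : Prop :=
  ∀ Y : Set X, DiscreteTopology Y → SeparatedFamily Y

/-- A separated family in `X` restricts to every subspace of `X`. -/
theorem SeparatedFamily.of_image_val {X : Type u} [TopologicalSpace X] {Y : Set X} {D : Set Y}
    (h : SeparatedFamily (Subtype.val '' D)) : SeparatedFamily D := by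
  obtain ⟨u, hu, hmem, hdisj⟩ := h
  refine ⟨fun d => Subtype.val ⁻¹' u ⟨d.1, Set.mem_image_of_mem _ d.2⟩,
    fun d => (hu _).preimage continuous_subtype_val, fun d => hmem _, fun d e hde => ?_⟩
  refine (hdisj _ _ fun he => hde ?_).preimage _
  exact Subtype.ext (Subtype.ext (Subtype.mk.inj he))

/-- A set of at most `κ` points with local neighborhood bases of size at most `κ` lies in a set
of at most `κ` points which meets the intersection of any two intersecting basic sets. -/
theorem exists_superset_meeting_inter {X : Type u} {κ : Cardinal.{u}} (hκ : ℵ₀ ≤ κ) (Y : Set X)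
    (hY : #Y ≤ κ) (B : X → Set (Set X)) (hB : ∀ x, #(B x) ≤ κ) :
    ∃ Z : Set X, Y ⊆ Z ∧ #Z ≤ κ ∧ ∀ y ∈ Y, ∀ z ∈ Y, ∀ s ∈ B y, ∀ t ∈ B z,
      (s ∩ t).Nonempty → (s ∩ t ∩ Z).Nonempty := by
  classical
  let J := Σ y : Y, B y
  have hJ : #J ≤ κ := by
    rw [mk_sigma]
    calc Cardinal.sum (fun y : Y => #(B y)) ≤ Cardinal.sum (fun _ : Y => κ) :=
          Cardinal.sum_le_sum _ _ fun y => hB y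
      _ = #Y * κ := by simp
      _ ≤ κ * κ := by gcongr
      _ = κ := mul_eq_self hκ
  let p : J × J → X := fun q =>
    if h : ((q.1.2 : Set X) ∩ q.2.2).Nonempty then h.some else q.1.1
  refine ⟨Y ∪ Set.range p, Set.subset_union_left, ?_, fun y hy z hz s hs t ht hst => ?_⟩
  · refine (mk_union_le _ _).trans (add_le_of_le hκ hY (mk_range_le.trans ?_))
    calc #(J × J) = #J * #J := by simp
      _ ≤ κ * κ := by gcongr
      _ = κ := mul_eq_self hκ
  · let q : J × J := (⟨⟨y, hy⟩, ⟨s, hs⟩⟩, ⟨⟨z, hz⟩, ⟨t, ht⟩⟩)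
    have hp : p q = hst.some := dif_pos hst
    exact ⟨p q, hp ▸ hst.some_mem, Or.inr ⟨q, rfl⟩⟩

/-- If every point of the Hausdorff space `X` has a neighborhood basis of cardinality at most
`χ ≤ λ`, with `λ` infinite, then `X` is `λ`-CWH (every subspace of cardinality `≤ λ` is CWH)
iff every discrete subset of cardinality `≤ λ` can be separated by pairwise disjoint open
subsets of `X`. -/
theorem stmt0 {X : Type u} [TopologicalSpace X] [T2Space X] (χ lam : Cardinal.{u})
    (hlam : ℵ₀ ≤ lam) (hchilam : χ ≤ lam)
    (hbasis : ∀ x : X, ∃ B : Set (Set X), #B ≤ χ ∧ (nhds x).HasBasis (fun s => s ∈ B) id) :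
    (∀ Y : Set X, #Y ≤ lam → IsCWH Y) ↔
      (∀ Y : Set X, #Y ≤ lam → DiscreteTopology Y → SeparatedFamily Y) := by
  constructor
  · intro h Y hY hYd
    choose B hBcard hB using hbasis
    obtain ⟨Z, hYZ, hZ, hmeet⟩ :=
      exists_superset_meeting_inter hlam Y hY B fun x => (hBcard x).trans hchilam
    have hD : DiscreteTopology (Subtype.val ⁻¹' Y : Set Z) :=
      DiscreteTopology.of_continuous_injective
        (f := fun d : (Subtype.val ⁻¹' Y : Set Z) => (⟨d.1.1, d.2⟩ : Y)) (by fun_prop)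
        fun d e hde => Subtype.ext (Subtype.ext (Subtype.mk.inj hde))
    obtain ⟨u, hu, hmem, hdisj⟩ := h Z hZ _ hD
    let i : Y → (Subtype.val ⁻¹' Y : Set Z) := fun y => ⟨⟨y, hYZ y.2⟩, y.2⟩
    have hex : ∀ y : Y, ∃ s ∈ B y, Subtype.val ⁻¹' s ⊆ u (i y) := by
      intro y
      have hnhds : u (i y) ∈ nhds (i y).1 := (hu _).mem_nhds (hmem _)
      rw [nhds_subtype_eq_comap] at hnhds
      exact ((hB y).comap _).mem_iff.1 hnhds
    choose s hs hsu using hex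
    refine ⟨fun y => interior (s y), fun _ => isOpen_interior,
      fun y => mem_interior_iff_mem_nhds.2 ((hB y).mem_of_mem (hs y)), fun y z hyz => ?_⟩
    refine Disjoint.mono interior_subset interior_subset ?_
    by_contra hne
    obtain ⟨x, ⟨hxy, hxz⟩, hxZ⟩ := hmeet y y.2 z z.2 _ (hs y) _ (hs z)
      (Set.not_disjoint_iff_nonempty_inter.1 hne)
    have hi : i y ≠ i z := fun hi =>
      hyz (Subtype.ext (congrArg (fun d => d.1.1) hi))
    exact Set.disjoint_left.1 (hdisj _ _ hi) (hsu y (a := ⟨x, hxZ⟩) hxy) (hsu z hxz)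
  · intro h Y hY D hD
    refine SeparatedFamily.of_image_val (h _ (mk_image_le.trans ((mk_set_le D).trans hY)) ?_)
    exact (Topology.IsEmbedding.subtypeVal.homeomorphImage D).symm.isEmbedding.discreteTopology
end

section
/- Let θ be an infinite regular cardinal and let H be a family of partial functions from ordinals to θ, each with domain of cardinality θ, with |H| ≤ θ. Then H is free: there is a function g from ordinals to θ such that for every h ∈ H there is ξ < θ with h(α) ≤ max(g(α), ξ) for all α ∈ Dom(h). (Consequently, no cardinal < θ⁺ belongs to SP_θ.) -/
open Cardinal

/-- A partial function from the ordinals to the ordinals, given by a domain and a total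
function (only values on the domain matter). -/
structure PartialOrdFn : Type 1 where
  dom : Set Ordinal.{0}
  fn : Ordinal.{0} → Ordinal.{0}

/-- A family `H` of partial functions from ordinals with values below `θ` is free if there is
a function `g` from ordinals to `θ` such that for every `h ∈ H` there is `ξ < θ` with
`h α ≤ max (g α) ξ` for all `α` in the domain of `h`. -/
def FreeFam (θ : Cardinal.{0}) (H : Set PartialOrdFn) : Prop :=
  ∃ g : Ordinal → Ordinal, (∀ α : Ordinal, g α < θ.ord) ∧
    ∀ h ∈ H, ∃ ξ < θ.ord, ∀ α ∈ h.dom, h.fn α ≤ max (g α) ξ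

/-- An injectively indexed family of ordinals below a regular cardinal `θ`, whose indices are
bounded in `θ`, is bounded below `θ`. -/
theorem exists_bound_of_injective {θ : Cardinal.{0}} (hθ : θ.IsRegular) {X : Type*}
    {f : X → Ordinal.{0}} {e : X → θ.ord.ToType} (he : Function.Injective e)
    {a : θ.ord.ToType} (hea : ∀ x, e x ≤ a) (hf : ∀ x, f x < θ.ord) :
    ∃ b < θ.ord, ∀ x, f x ≤ b := by
  have hIic : #(Set.Iic a) < θ := by
    rw [← Set.Iio_insert]
    have hIio : #(Set.Iio a) < θ := by simpa using mk_Iio_lt a (by simp)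
    exact mk_insert_le.trans_lt
      (add_lt_of_lt hθ.aleph0_le hIio (one_lt_aleph0.trans_le hθ.aleph0_le))
  have hrange : #(Set.range e) < θ :=
    (mk_le_mk_of_subset (Set.range_subset_iff.2 hea)).trans_lt hIic
  let r := (Equiv.ofInjective e he).symm
  refine ⟨⨆ y, f (r y), Ordinal.iSup_lt_of_lt_cof (by rwa [hθ.cof_ord]) fun y => hf _, fun x => ?_⟩
  simpa [r] using Ordinal.le_iSup (fun y => f (r y)) (Equiv.ofInjective e he x)

/-- A type of cardinality at most `θ` injects into the initial ordinal of `θ`. -/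
theorem exists_injective_ord_toType {θ : Cardinal.{0}} {X : Type 1}
    (hX : #X ≤ Cardinal.lift.{1} θ) : ∃ e : X → θ.ord.ToType, Function.Injective e := by
  rw [← Cardinal.lift_id'.{0, 1} #X, ← mk_ord_toType θ] at hX
  obtain ⟨e⟩ := Cardinal.lift_mk_le'.1 hX
  exact ⟨e, e.injective⟩

/-- Any family of at most `θ` partial functions from ordinals to `θ`, each with domain of
cardinality `θ`, is free (`θ` an infinite regular cardinal).  Consequently no cardinal
`< θ⁺` belongs to `SP_θ`. -/
theorem stmt12 (θ : Cardinal.{0}) (hθ : θ.IsRegular) (H : Set PartialOrdFn)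
    (hmem : ∀ h ∈ H, (∀ α ∈ h.dom, h.fn α < θ.ord) ∧ #h.dom = Cardinal.lift.{1} θ)
    (hcard : #H ≤ Cardinal.lift.{1} θ) :
    FreeFam θ H := by
  have hunion : #(⋃ h : H, h.1.dom) ≤ Cardinal.lift.{1} θ :=
    calc #(⋃ h : H, h.1.dom) ≤ #H * ⨆ h : H, #h.1.dom := mk_iUnion_le _
      _ ≤ Cardinal.lift.{1} θ * Cardinal.lift.{1} θ :=
        mul_le_mul' hcard (ciSup_le' fun h => (hmem h h.2).2.le)
      _ = Cardinal.lift.{1} θ := mul_eq_self (aleph0_le_lift.2 hθ.aleph0_le)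
  obtain ⟨e, he⟩ := exists_injective_ord_toType hcard
  obtain ⟨d, hd⟩ := exists_injective_ord_toType hunion
  have hg : ∀ α, ∃ b < θ.ord, ∀ (h : H) (hα : α ∈ h.1.dom),
      e h ≤ d ⟨α, Set.mem_iUnion_of_mem h hα⟩ → h.1.fn α ≤ b := by
    intro α
    by_cases hα : α ∈ ⋃ h : H, h.1.dom
    · obtain ⟨b, hb, hle⟩ := exists_bound_of_injective hθ
        (X := {h : H // α ∈ h.1.dom ∧ e h ≤ d ⟨α, hα⟩}) (f := fun h => h.1.1.fn α)
        (e := fun h => e h.1) (he.comp Subtype.val_injective) (fun h => h.2.2)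
        (fun h => (hmem h.1 h.1.2).1 α h.2.1)
      exact ⟨b, hb, fun h hdom hed => hle ⟨h, hdom, hed⟩⟩
    · exact ⟨0, hθ.ord_pos, fun h hdom => absurd (Set.mem_iUnion_of_mem h hdom) hα⟩
  choose g hgθ hg using hg
  refine ⟨g, hgθ, fun h hh => ?_⟩
  let i : h.dom → ⋃ h : H, h.1.dom :=
    Set.inclusion (Set.subset_iUnion (fun h : H => h.1.dom) ⟨h, hh⟩)
  have hi : Function.Injective i := Set.inclusion_injective _
  obtain ⟨ξ, hξ, hle⟩ := exists_bound_of_injective hθ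
    (X := {α : h.dom // d (i α) ≤ e ⟨h, hh⟩}) (f := fun α => h.fn α.1)
    (e := fun α => d (i α.1)) ((hd.comp hi).comp Subtype.val_injective) (fun α => α.2)
    (fun α => (hmem h hh).1 α.1 α.1.2)
  refine ⟨ξ, hξ, fun α hα => ?_⟩
  rcases le_total (e ⟨h, hh⟩) (d (i ⟨α, hα⟩)) with hed | hed
  · exact le_max_of_le_left (hg α ⟨h, hh⟩ hα hed)
  · exact le_max_of_le_right (hle ⟨⟨α, hα⟩, hed⟩)
end

section
/- Let θ be an infinite regular cardinal and let 𝔟[θ] be the minimal cardinality of a family F ⊆ θ^θ such that there is no g ∈ θ^θ with: for every f ∈ F there is ζ < θ with f(ε) < g(ε) for all ε with ζ ≤ ε < θ. Then for every ordinal σ with 1 ≤ σ ≤ θ⁺, 𝔟[θ] ∈ SP_{θ,σ}. -/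
open Cardinal

/-- `H` is `σ`-free: it is a union of fewer than `1 + σ` free families. -/
def SigmaFree (θ : Cardinal.{0}) (σ : Ordinal.{0}) (H : Set PartialOrdFn) : Prop :=
  ∃ (k : Ordinal) (Hs : Ordinal → Set PartialOrdFn), k < 1 + σ ∧
    H = ⋃ i ∈ Set.Iio k, Hs i ∧ ∀ i < k, FreeFam θ (Hs i)

/-- `lam ∈ SP_{θ,σ}`: there is a family of partial functions from ordinals to `θ`, each with
domain of cardinality `θ`, of cardinality `lam`, every subfamily of cardinality `< lam` of
which is `σ`-free, while the family itself is not `σ`-free. -/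
def SPmem (θ : Cardinal.{0}) (σ : Ordinal.{0}) (lam : Cardinal.{0}) : Prop :=
  ∃ H : Set PartialOrdFn,
    (∀ h ∈ H, (∀ α ∈ h.dom, h.fn α < θ.ord) ∧ #h.dom = Cardinal.lift.{1} θ) ∧
    #H = Cardinal.lift.{1} lam ∧
    (∀ H' ⊆ H, #H' < Cardinal.lift.{1} lam → SigmaFree θ σ H') ∧
    ¬SigmaFree θ σ H

/-- `𝔟[θ]`: the minimal cardinality of a family `F ⊆ θ^θ` which is not eventually strictly
dominated by any single `g ∈ θ^θ`. -/
noncomputable def bTheta (θ : Cardinal.{0}) : Cardinal.{0} :=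
  sInf { c | ∃ F : Set (Ordinal.{0} → Ordinal.{0}),
    (∀ f ∈ F, ∀ ε : Ordinal, (ε < θ.ord → f ε < θ.ord) ∧ (θ.ord ≤ ε → f ε = 0)) ∧
    Cardinal.lift.{1} c = #F ∧
    ¬∃ g : Ordinal → Ordinal, (∀ ε < θ.ord, g ε < θ.ord) ∧
      ∀ f ∈ F, ∃ ζ < θ.ord, ∀ ε : Ordinal, ζ ≤ ε → ε < θ.ord → f ε < g ε }

/-- A set of fewer than `θ` ordinals below the regular cardinal `θ` is bounded below `θ`. -/
theorem exists_bound_of_mk_lt {θ : Cardinal.{0}} (hθ : θ.IsRegular) {s : Set Ordinal.{0}}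
    (hs : ∀ a ∈ s, a < θ.ord) (hcard : #s < Cardinal.lift.{1} θ) :
    ∃ b < θ.ord, ∀ a ∈ s, a ≤ b := by
  refine ⟨sSup s, Ordinal.sSup_lt_of_lt_cof ?_ hs, fun a ha => ?_⟩
  · rwa [← Ordinal.lift_cof, hθ.cof_ord]
  · exact le_csSup ⟨θ.ord, fun a ha => (hs a ha).le⟩ ha

theorem mk_Iio_lt_lift {θ : Cardinal.{0}} {ε : Ordinal.{0}} (hε : ε < θ.ord) :
    #(Set.Iio ε) < Cardinal.lift.{1} θ := by
  rw [Cardinal.mk_Iio_ordinal, Cardinal.lift_lt]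
  exact Cardinal.lt_ord.1 hε

theorem SigmaFree.of_freeFam {θ : Cardinal.{0}} {σ : Ordinal.{0}} (hσ : 1 ≤ σ)
    {H : Set PartialOrdFn} (hH : FreeFam θ H) : SigmaFree θ σ H := by
  refine ⟨1, fun _ => H, ?_, ?_, fun _ _ => hH⟩
  · calc (1 : Ordinal) < 1 + 1 := lt_add_of_pos_right _ zero_lt_one
      _ ≤ 1 + σ := by gcongr
  · ext x
    simp only [Set.mem_iUnion, Set.mem_Iio, exists_prop]
    exact ⟨fun hx => ⟨0, zero_lt_one, hx⟩, fun ⟨_, _, hx⟩ => hx⟩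

/-- `f` viewed as a partial function with domain `θ`. -/
def PartialOrdFn.ofFun (θ : Cardinal.{0}) (f : Ordinal.{0} → Ordinal.{0}) : PartialOrdFn :=
  ⟨Set.Iio θ.ord, f⟩

theorem PartialOrdFn.ofFun_injective (θ : Cardinal.{0}) :
    Function.Injective (PartialOrdFn.ofFun θ) :=
  fun _ _ h => congrArg PartialOrdFn.fn h

/-- The family `F` is eventually strictly dominated on `θ` by a single function. -/
def EvDominated (θ : Cardinal.{0}) (F : Set (Ordinal.{0} → Ordinal.{0})) : Prop :=
  ∃ g : Ordinal → Ordinal, (∀ ε < θ.ord, g ε < θ.ord) ∧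
    ∀ f ∈ F, ∃ ζ < θ.ord, ∀ ε : Ordinal, ζ ≤ ε → ε < θ.ord → f ε < g ε

theorem EvDominated.freeFam {θ : Cardinal.{0}} (hθ : θ.IsRegular)
    {F : Set (Ordinal.{0} → Ordinal.{0})} (hF : ∀ f ∈ F, ∀ ε < θ.ord, f ε < θ.ord)
    (h : EvDominated θ F) : FreeFam θ (PartialOrdFn.ofFun θ '' F) := by
  classical
  obtain ⟨g, hg, hdom⟩ := h
  refine ⟨fun α => if α < θ.ord then g α else 0, fun α => ?_, ?_⟩
  · dsimp only
    split_ifs with hα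
    · exact hg α hα
    · exact hθ.ord_pos
  · rintro _ ⟨f, hf, rfl⟩
    obtain ⟨ζ, hζ, hlt⟩ := hdom f hf
    obtain ⟨ξ, hξ, hb⟩ := exists_bound_of_mk_lt hθ (s := f '' Set.Iio ζ)
      (by rintro _ ⟨a, ha, rfl⟩; exact hF f hf a (lt_trans ha hζ))
      (Cardinal.mk_image_le.trans_lt (mk_Iio_lt_lift hζ))
    refine ⟨ξ, hξ, fun α (hα : α < θ.ord) => ?_⟩
    change f α ≤ max (if α < θ.ord then g α else 0) ξ
    rw [if_pos hα]
    rcases lt_or_ge α ζ with h | h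
    · exact le_max_of_le_right (hb _ ⟨α, h, rfl⟩)
    · exact le_max_of_le_left (hlt α h hα).le

/-- A union of at most `θ` free families of functions on `θ` is eventually dominated. -/
theorem SigmaFree.evDominated {θ : Cardinal.{0}} (hθ : θ.IsRegular) {σ : Ordinal.{0}}
    (hσ : σ ≤ (Order.succ θ).ord) {F : Set (Ordinal.{0} → Ordinal.{0})}
    (h : SigmaFree θ σ (PartialOrdFn.ofFun θ '' F)) : EvDominated θ F := by
  obtain ⟨k, Hs, hk, hunion, hfree⟩ := h
  have hkcard : k.card ≤ θ := by
    have hω : Ordinal.omega0 ≤ (Order.succ θ).ord :=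
      Cardinal.omega0_le_ord.2 (hθ.aleph0_le.trans (Order.le_succ θ))
    have : k < (Order.succ θ).ord := by
      refine hk.trans_le ?_
      rw [← Ordinal.one_add_of_omega0_le hω]
      gcongr
    exact Order.lt_succ_iff.1 (Cardinal.lt_ord.1 this)
  have hle : #(Set.Iio k) ≤ #(Set.Iio θ.ord) := by
    rwa [Cardinal.mk_Iio_ordinal, Cardinal.mk_Iio_ordinal, Cardinal.lift_le, Cardinal.card_ord]
  obtain ⟨e⟩ := hle
  choose g hg hgb using fun i : Set.Iio k => hfree i i.2
  have hsup : ∀ ε < θ.ord, ∃ b < θ.ord, ∀ i, (e i : Ordinal) < ε → g i ε ≤ b := by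
    intro ε hε
    obtain ⟨b, hb, hle⟩ := exists_bound_of_mk_lt hθ
      (s := (fun i => g i ε) '' {i | (e i : Ordinal) < ε})
      (by rintro _ ⟨i, -, rfl⟩; exact hg i ε) (by
        refine Cardinal.mk_image_le.trans_lt (lt_of_le_of_lt ?_ (mk_Iio_lt_lift hε))
        refine Cardinal.mk_le_of_injective
          (f := fun i : {i | (e i : Ordinal) < ε} => (⟨e i.1, i.2⟩ : Set.Iio ε)) ?_
        intro i j hij
        have hval : (e i.1 : Ordinal) = e j.1 := congrArg (fun x : Set.Iio ε => x.1) hij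
        exact Subtype.ext (e.injective (Subtype.ext hval)))
    exact ⟨b, hb, fun i hi => hle _ ⟨i, hi, rfl⟩⟩
  choose! G hG hGb using hsup
  have hlim := Cardinal.isSuccLimit_ord hθ.aleph0_le
  refine ⟨fun ε => Order.succ (max (G ε) ε), fun ε hε =>
    hlim.succ_lt (max_lt (hG ε hε) hε), fun f hf => ?_⟩
  have hmem : PartialOrdFn.ofFun θ f ∈ ⋃ i ∈ Set.Iio k, Hs i :=
    hunion ▸ Set.mem_image_of_mem _ hf
  simp only [Set.mem_iUnion] at hmem
  obtain ⟨i, hi, hfi⟩ := hmem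
  obtain ⟨ξ, hξ, hb⟩ := hgb ⟨i, hi⟩ _ hfi
  refine ⟨max ξ (Order.succ (e ⟨i, hi⟩ : Ordinal)),
    max_lt hξ (hlim.succ_lt (e ⟨i, hi⟩).2), fun ε hζ hε => Order.lt_succ_iff.2 ?_⟩
  have hξε : ξ ≤ ε := (le_max_left _ _).trans hζ
  have heε : (e ⟨i, hi⟩ : Ordinal) < ε := Order.succ_le_iff.1 ((le_max_right _ _).trans hζ)
  exact (hb ε hε).trans (max_le_max (hGb ε hε _ heε) hξε)

/-- The functions from `θ` to `θ`, extended by `0` outside `θ`. -/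
def funsBelow (θ : Cardinal.{0}) : Set (Ordinal.{0} → Ordinal.{0}) :=
  {f | ∀ ε : Ordinal, (ε < θ.ord → f ε < θ.ord) ∧ (θ.ord ≤ ε → f ε = 0)}

instance small_funsBelow (θ : Cardinal.{0}) : Small.{0} (funsBelow θ) := by
  refine small_of_injective (β := Set.Iio θ.ord → Set.Iio θ.ord)
    (f := fun f ε => ⟨f.1 ε, (f.2 ε).1 ε.2⟩) fun f f' h => ?_
  refine Subtype.ext (funext fun ε => ?_)
  rcases lt_or_ge ε θ.ord with hε | hε
  · exact congrArg Subtype.val (congrFun h ⟨ε, hε⟩)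
  · rw [(f.2 ε).2 hε, (f'.2 ε).2 hε]

theorem exists_lift_eq_mk_of_small {α : Type 1} [Small.{0} α] :
    ∃ c : Cardinal.{0}, Cardinal.lift.{1} c = #α :=
  ⟨#(Shrink.{0} α), by simp⟩

theorem not_evDominated_funsBelow {θ : Cardinal.{0}} : ¬EvDominated θ (funsBelow θ) := by
  classical
  rintro ⟨g, hg, h⟩
  obtain ⟨ζ, hζ, hlt⟩ := h (fun ε => if ε < θ.ord then g ε else 0) fun ε =>
    ⟨fun hε => by simpa [hε] using hg ε hε, fun hε => if_neg hε.not_gt⟩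
  simpa [hζ] using hlt ζ le_rfl hζ

theorem exists_not_evDominated_mk_eq_bTheta (θ : Cardinal.{0}) :
    ∃ F ⊆ funsBelow θ, Cardinal.lift.{1} (bTheta θ) = #F ∧ ¬EvDominated θ F := by
  obtain ⟨c, hc⟩ := exists_lift_eq_mk_of_small (α := funsBelow θ)
  exact csInf_mem (s := { c : Cardinal.{0} | ∃ F ⊆ funsBelow θ,
    Cardinal.lift.{1} c = #F ∧ ¬EvDominated θ F })
    ⟨c, funsBelow θ, subset_rfl, hc, not_evDominated_funsBelow⟩

theorem evDominated_of_mk_lt_bTheta {θ : Cardinal.{0}} {F : Set (Ordinal.{0} → Ordinal.{0})}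
    (hF : F ⊆ funsBelow θ) (hcard : #F < Cardinal.lift.{1} (bTheta θ)) : EvDominated θ F := by
  by_contra h
  have : Small.{0} F := small_subset hF
  obtain ⟨c, hc⟩ := exists_lift_eq_mk_of_small (α := F)
  rw [← hc, Cardinal.lift_lt] at hcard
  exact hcard.not_ge (csInf_le' ⟨F, hF, hc, h⟩)

theorem stmt13 (θ : Cardinal.{0}) (hθ : θ.IsRegular) (σ : Ordinal.{0})
    (hσ1 : 1 ≤ σ) (hσ2 : σ ≤ (Order.succ θ).ord) :
    SPmem θ σ (bTheta θ) := by
  obtain ⟨F, hF, hcard, hdom⟩ := exists_not_evDominated_mk_eq_bTheta θ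
  refine ⟨PartialOrdFn.ofFun θ '' F, ?_, ?_, ?_, fun h => hdom (h.evDominated hθ hσ2)⟩
  · rintro _ ⟨f, hf, rfl⟩
    refine ⟨fun α hα => (hF hf α).1 hα, ?_⟩
    change #(Set.Iio θ.ord) = _
    rw [Cardinal.mk_Iio_ordinal, Cardinal.card_ord]
  · rw [Cardinal.mk_image_eq (PartialOrdFn.ofFun_injective θ), hcard]
  · intro H' hH' hlt
    obtain ⟨F', hF', rfl⟩ := Set.subset_image_iff.1 hH'
    rw [Cardinal.mk_image_eq (PartialOrdFn.ofFun_injective θ)] at hlt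
    have hF'' := hF'.trans hF
    exact .of_freeFam hσ1 <| (evDominated_of_mk_lt_bTheta hF'' hlt).freeFam hθ
      fun f hf ε => (hF'' hf ε).1
end
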